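/- Let Γ=(G,𝓛) be a terminal game satisfying condition (CIW), and let σ be a situation such that the play P(σ,v) is finite (reaches a terminal) for every position v∈V. If σ' is obtained from σ by a uniform best improvement of one of the players, then the plays P(σ',v) are also finite for every v∈V. -/

import Mathlib

open scoped Classical

section CoreDefs

variable {V : Type}

/-- A position is terminal iff it has no outgoing edges. -/
def Terminal (E : V → V → Prop) (v : V) : Prop := ∀ u, ¬ E v u

/-- A situation (profile of pure stationary strategies), encoded as a single
successor map: at every non-terminal position it must follow an edge. -/
def IsSituation (E : V → V → Prop) (s : V → V) : Prop :=
  ∀ v, ¬ Terminal E v → E v (s v)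

/-- `s'` is a unilateral deviation of player `i` from `s`: they agree at every
position not controlled by `i` (terminals are controlled by nobody). -/
def Deviation {n : ℕ} (E : V → V → Prop) (owner : V → Fin n) (i : Fin n)
    (s s' : V → V) : Prop :=
  ∀ v, (owner v ≠ i ∨ Terminal E v) → s' v = s v

/-- The play of `s` started at `v` reaches a terminal position. -/
def Reaches (E : V → V → Prop) (s : V → V) (v : V) : Prop :=
  ∃ k, Terminal E (s^[k] v)

/-- First time the play of `s` from `v` is at a terminal position. -/
noncomputable def stopTime (E : V → V → Prop) (s : V → V) (v : V) : ℕ :=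
  sInf {k | Terminal E (s^[k] v)}

/-- The terminal position reached by the play of `s` from `v` (junk if none). -/
noncomputable def playEnd (E : V → V → Prop) (s : V → V) (v : V) : V :=
  s^[stopTime E s v] v

/-- Effective cost in a terminal game: the cost of the terminal reached,
`0` for an infinite play. -/
noncomputable def tCost (E : V → V → Prop) (L : V → ℝ) (s : V → V) (v : V) : ℝ :=
  if Reaches E s v then L (playEnd E s v) else 0

/-- Effective cost in a positive shortest path game: the total length of the
play if it terminates, `+∞` for an infinite play. -/
noncomputable def spCost (E : V → V → Prop) (l : V → V → ℝ) (s : V → V) (v : V) : EReal :=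
  if Reaches E s v then
    (((Finset.range (stopTime E s v)).sum fun k => l (s^[k] v) (s^[k+1] v) : ℝ) : EReal)
  else ⊤

/-- Edge-symmetry: every move can be reversed, except moves entering terminals. -/
def EdgeSymm (E : V → V → Prop) : Prop :=
  ∀ u v, E u v → ¬ Terminal E v → E v u

end CoreDefs
section UniformDefs

variable {V : Type}

/-- `s` is a situation in which player `i`'s strategy is a uniform best
response to the opponents' strategies: no unilateral deviation of `i`
improves `i`'s cost from any initial position. -/
def UBR {n : ℕ} (E : V → V → Prop) (owner : V → Fin n) (L : Fin n → V → ℝ)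
    (i : Fin n) (s : V → V) : Prop :=
  ∀ s', IsSituation E s' → Deviation E owner i s s' →
    ∀ v, tCost E (L i) s v ≤ tCost E (L i) s' v

/-- `s'` is obtained from `s` by a uniform best improvement of player `i`. -/
def UBI {n : ℕ} (E : V → V → Prop) (owner : V → Fin n) (L : Fin n → V → ℝ)
    (i : Fin n) (s s' : V → V) : Prop :=
  IsSituation E s' ∧ Deviation E owner i s s' ∧ s' ≠ s ∧
  UBR E owner L i s' ∧
  ∀ v, owner v = i → ¬ Terminal E v →
    s' v = s v ∨ tCost E (L i) s' v < tCost E (L i) s v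

/-- `s` is `i`-basic: every position `v` with a terminal out-neighbour `w`
either uses the terminal move, or every uniform best improvement of player `i`
gives the owner of `v` a strictly better value at `v` than that terminal. -/
def IBasic {n : ℕ} (E : V → V → Prop) (owner : V → Fin n) (L : Fin n → V → ℝ)
    (i : Fin n) (s : V → V) : Prop :=
  ∀ v w, E v w → Terminal E w →
    s v = w ∨ ∀ s', UBI E owner L i s s' → tCost E (L (owner v)) s' v < L (owner v) w

/-- (S1): every edge between two distinct non-terminal vertices joins positions
of different players. -/
def CondS1 {n : ℕ} (E : V → V → Prop) (owner : V → Fin n) : Prop :=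
  ∀ u v, E u v → u ≠ v → ¬ Terminal E u → ¬ Terminal E v → owner u ≠ owner v

/-- (S2): every position has at most one terminal out-neighbour. -/
def CondS2 (E : V → V → Prop) : Prop :=
  ∀ v w w', E v w → E v w' → Terminal E w → Terminal E w' → w = w'

/-- (S3): a terminal position is reachable from every position. -/
def CondS3 (E : V → V → Prop) : Prop :=
  ∀ v : V, ∃ w, Terminal E w ∧ Relation.ReflTransGen E v w

/-- Uniform Nash equilibrium: a situation that is a Nash equilibrium for every
choice of the initial position. -/
def IsUNE {n : ℕ} (E : V → V → Prop) (owner : V → Fin n) (L : Fin n → V → ℝ)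
    (s : V → V) : Prop :=
  IsSituation E s ∧ ∀ i s', IsSituation E s' → Deviation E owner i s s' →
    ∀ v, tCost E (L i) s v ≤ tCost E (L i) s' v

end UniformDefs

/-- A play that reaches a terminal position ends at one. -/
theorem Reaches.terminal_playEnd {V : Type} {E : V → V → Prop} {s : V → V} {v : V}
    (h : Reaches E s v) : Terminal E (playEnd E s v) :=
  Nat.sInf_mem (s := {k | Terminal E (s^[k] v)}) h

/-- In a terminal game satisfying (CIW), if all plays of the
situation `σ` are finite (reach a terminal from every position) and `σ'` is
obtained from `σ` by a uniform best improvement of one of the players, then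
all plays of `σ'` are finite as well. -/
theorem uniformBestImprovement_preserves_finiteness
    {V : Type} [Fintype V] {n : ℕ}
    (E : V → V → Prop) (owner : V → Fin n) (L : Fin n → V → ℝ)
    (hT : ∃ v, Terminal E v)        -- the set of terminals is nonempty
    (hCIW : ∀ i w, Terminal E w → L i w < 0)  -- (CIW)
    (s : V → V) (hs : IsSituation E s)
    (hfin : ∀ v, Reaches E s v)     -- all plays of `σ` are finite
    (i : Fin n) (s' : V → V)
    (h : UBI E owner L i s s')      -- `σ'` is a uniform best improvement of player `i`
    :
    ∀ v, Reaches E s' v := by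
  intro v
  by_contra hv
  obtain ⟨-, hdev, -, hbest, -⟩ := h
  have hle := hbest s hs (fun u hu => (hdev u hu).symm) v
  rw [tCost, tCost, if_neg hv, if_pos (hfin v)] at hle
  exact (hCIW i _ (hfin v).terminal_playEnd).not_ge hle
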